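/- arXiv:0801.2314 — 2 statements merged into one kernel-verified Lean document; each statement's English description precedes it below -/
import Mathlib

section
/- Let L be a locally compact Hausdorff space, let X be a real Banach space, and let Y be a real Banach space that does not contain an isomorphic copy of c₀. For a continuous linear operator T : C₀(L,X) → Y and a subset A ⊆ L, define osc_T(A) = sup{ ‖T F‖ : F ∈ C₀(L,X), ‖F‖_∞ ≤ 1, and F(t) = 0 for all t ∈ L \ A }. Then for every sequence (V_n)_{n∈ℕ} of pairwise disjoint nonempty open subsets of L, one has osc_T(V_n) → 0 as n → ∞. -/
open scoped ZeroAtInfty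

/-- `osc_T(A)`: the supremum of `‖T F‖` over `F` in the unit ball of `C₀(L, X)`
vanishing off `A`. -/
noncomputable def oscT {L : Type*} [TopologicalSpace L]
    {X Y : Type*} [NormedAddCommGroup X] [NormedSpace ℝ X]
    [NormedAddCommGroup Y] [NormedSpace ℝ Y]
    (T : C₀(L, X) →L[ℝ] Y) (A : Set L) : ℝ :=
  sSup {r : ℝ | ∃ F : C₀(L, X), ‖F‖ ≤ 1 ∧ (∀ t ∉ A, F t = 0) ∧ r = ‖T F‖}

open scoped ENNReal in
lemma rosenthal_aux (δ : ℝ≥0∞) (hδ : δ ≠ ∞) (n : ℕ) :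
    ∀ m : ℕ → ℕ → ℝ≥0∞, (∀ k, ∑' j, m k j ≤ n * δ) →
      ∃ φ : ℕ → ℕ, Function.Injective φ ∧
        ∀ k, ∑' j, (if j = k then 0 else m (φ k) (φ j)) ≤ δ := by
  induction n with
  | zero =>
    intro m hm
    refine ⟨id, Function.injective_id, fun k => ?_⟩
    refine le_trans (ENNReal.tsum_le_tsum (g := fun j => m k j) fun j => ?_) ((hm k).trans ?_)
    · simp only [id]
      split_ifs <;> simp
    · simp
  | succ n ih =>
    intro m hm
    by_cases h : ∃ p, ∀ i, ∑' j, (if j = i then 0 else m (Nat.pair p i) (Nat.pair p j)) ≤ δ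
    · obtain ⟨p, hp⟩ := h
      refine ⟨fun i => Nat.pair p i, fun a b hab => ?_, hp⟩
      exact (Nat.pair_eq_pair.1 hab).2
    · push Not at h
      choose i hi using h
      have hinj : Function.Injective (fun p => Nat.pair p (i p)) := fun a b hab =>
        (Nat.pair_eq_pair.1 hab).1
      obtain ⟨φ, hφ, hφ'⟩ := ih (fun p q => m (Nat.pair p (i p)) (Nat.pair q (i q))) (by
        intro p
        have key : ∑' q, m (Nat.pair p (i p)) (Nat.pair q (i q)) +
            ∑' j, (if j = i p then 0 else m (Nat.pair p (i p)) (Nat.pair p j))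
            ≤ ∑' j, m (Nat.pair p (i p)) j := by
          set f := m (Nat.pair p (i p)) with hf
          rw [← Nat.pairEquiv.tsum_eq f, ENNReal.tsum_prod' (f := fun x => f (Nat.pairEquiv x))]
          have e : ∑' j, (if j = i p then 0 else f (Nat.pair p j)) =
              ∑' q, (if q = p then ∑' j, (if j = i p then 0 else f (Nat.pair p j)) else 0) := by
            rw [tsum_ite_eq]
          rw [e, ← ENNReal.tsum_add]
          refine ENNReal.tsum_le_tsum fun q => ?_
          split_ifs with hq
          · subst hq
            have h5 := (ENNReal.tsum_eq_add_tsum_ite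
              (f := fun b => f (Nat.pairEquiv (q, b))) (i q)).ge
            refine le_trans (add_le_add le_rfl (ENNReal.tsum_le_tsum fun x => ?_)) h5
            by_cases hx : x = i q <;> simp [hx]
          · rw [add_zero]
            exact ENNReal.le_tsum (f := fun b => f (Nat.pairEquiv (q, b))) (i q)
        have h2 := (add_le_add_right (hi p).le _).trans (key.trans (hm _))
        push_cast at h2
        rw [add_mul, one_mul] at h2
        exact (ENNReal.add_le_add_iff_right hδ).1 h2)
      exact ⟨fun k => Nat.pair (φ k) (i (φ k)), hinj.comp hφ, hφ'⟩

lemma rosenthal_real (c : ℕ → ℕ → ℝ) (M δ : ℝ) (hδ : 0 < δ)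
    (hM : ∀ k (s : Finset ℕ), ∑ j ∈ s, |c k j| ≤ M) :
    ∃ φ : ℕ → ℕ, Function.Injective φ ∧
      ∀ k (s : Finset ℕ), k ∉ s → ∑ j ∈ s, |c (φ k) (φ j)| ≤ δ := by
  obtain ⟨n, hn⟩ := exists_nat_ge (M / δ)
  have hn' : M ≤ n * δ := (div_le_iff₀ hδ).1 hn
  obtain ⟨φ, h1, h2⟩ := rosenthal_aux (ENNReal.ofReal δ) ENNReal.ofReal_ne_top n
    (fun k j => ENNReal.ofReal |c k j|) (by
      intro k
      rw [ENNReal.tsum_eq_iSup_sum]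
      refine iSup_le fun s => ?_
      rw [← ENNReal.ofReal_sum_of_nonneg (fun _ _ => abs_nonneg _), ← ENNReal.ofReal_natCast,
        ← ENNReal.ofReal_mul (by positivity)]
      exact ENNReal.ofReal_le_ofReal ((hM k s).trans hn'))
  refine ⟨φ, h1, fun k s hk => ?_⟩
  have h3 := (ENNReal.sum_le_tsum s).trans (h2 k)
  rw [Finset.sum_congr rfl (g := fun j => ENNReal.ofReal |c (φ k) (φ j)|) (by
    intro j hj
    rw [if_neg]
    rintro rfl
    exact hk hj), ← ENNReal.ofReal_sum_of_nonneg (fun _ _ => abs_nonneg _)] at h3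
  exact (ENNReal.ofReal_le_ofReal_iff hδ.le).1 h3

lemma c0_coord_le (a : C₀(ℕ, ℝ)) (j : ℕ) : |a j| ≤ ‖a‖ := by
  rw [← ZeroAtInftyContinuousMap.norm_toBCF_eq_norm]
  exact a.toBCF.norm_coe_le_norm j

lemma exists_c0_copy {Y : Type*} [NormedAddCommGroup Y] [NormedSpace ℝ Y] [CompleteSpace Y]
    (y : ℕ → Y) (M ε : ℝ) (hM0 : 0 ≤ M) (hε : 0 < ε) (hy : ∀ k, ε ≤ ‖y k‖)
    (hM : ∀ (s : Finset ℕ) (a : ℕ → ℝ) (C : ℝ), 0 ≤ C → (∀ j ∈ s, |a j| ≤ C) →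
      ‖∑ j ∈ s, a j • y j‖ ≤ M * C) :
    ∃ J : C₀(ℕ, ℝ) →L[ℝ] Y, ∃ c > 0, ∀ f : C₀(ℕ, ℝ), c * ‖f‖ ≤ ‖J f‖ := by
  have hg : ∀ k, ∃ g : Y →L[ℝ] ℝ, ‖g‖ = 1 ∧ g (y k) = ‖y k‖ := fun k => by
    obtain ⟨g, h1, h2⟩ := exists_dual_vector ℝ (y k)
      (hε.trans_le (hy k)).ne'
    exact ⟨g, h1, by simpa using h2⟩
  choose g hg1 hg2 using hg
  have hgle : ∀ k x, |g k x| ≤ ‖x‖ := fun k x => by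
    have := (g k).le_opNorm x
    rwa [hg1, one_mul] at this
  obtain ⟨φ, hφ, hoff⟩ := rosenthal_real (fun k j => g k (y j)) M (ε / 2) (half_pos hε) (by
    intro k s
    have h1 := hM s (fun j => SignType.sign (g k (y j))) 1 zero_le_one (by
      intro j _
      rcases lt_trichotomy (g k (y j)) 0 with h | h | h <;> simp [h])
    have h2 := (hgle k _).trans h1
    rw [mul_one, map_sum] at h2
    refine le_trans (le_of_eq ?_) ((le_abs_self _).trans h2)
    refine Finset.sum_congr rfl fun j _ => ?_
    rw [map_smul, smul_eq_mul, sign_mul_self])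
  have hMφ : ∀ (s : Finset ℕ) (a : ℕ → ℝ) (C : ℝ), 0 ≤ C → (∀ j ∈ s, |a j| ≤ C) →
      ‖∑ j ∈ s, a j • y (φ j)‖ ≤ M * C := by
    intro s a C hC ha
    have := hM (s.map ⟨φ, hφ⟩) (fun i => a (Function.invFun φ i)) C hC (by
      intro i hi
      obtain ⟨j, hj, rfl⟩ := Finset.mem_map.1 hi
      simpa [Function.leftInverse_invFun hφ j] using ha j hj)
    rw [Finset.sum_map] at this
    simpa [Function.leftInverse_invFun hφ _] using this
  have hsum : ∀ a : C₀(ℕ, ℝ), Summable fun j => a j • y (φ j) := by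
    intro a
    rw [summable_iff_vanishing_norm]
    intro η hη
    have hpos : 0 < η / (M + 1) := by positivity
    have h0 : Filter.Tendsto a Filter.cofinite (nhds 0) := by
      have := zero_at_infty a
      rwa [Filter.cocompact_eq_cofinite] at this
    have hfin := (Metric.tendsto_nhds.1 h0 _ hpos)
    rw [Filter.eventually_cofinite] at hfin
    refine ⟨hfin.toFinset, fun t ht => ?_⟩
    refine (hMφ t a (η / (M + 1)) hpos.le fun j hj => ?_).trans_lt ?_
    · have := Finset.disjoint_left.1 ht hj
      simp at this
      exact this.le
    · rw [mul_div_assoc', div_lt_iff₀ (by positivity)]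
      nlinarith
  let J0 : C₀(ℕ, ℝ) →ₗ[ℝ] Y :=
    { toFun := fun a => ∑' j, a j • y (φ j)
      map_add' := fun a b => by
        rw [← (hsum a).tsum_add (hsum b)]
        simp [add_smul]
      map_smul' := fun r a => by
        simp only [RingHom.id_apply]
        rw [← (hsum a).tsum_const_smul]
        simp [mul_smul] }
  have hJ0 : ∀ a, HasSum (fun j => a j • y (φ j)) (J0 a) := fun a => (hsum a).hasSum
  let J : C₀(ℕ, ℝ) →L[ℝ] Y := J0.mkContinuous M (by
    intro a
    refine le_of_tendsto (hJ0 a).norm (Filter.Eventually.of_forall fun s => ?_)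
    exact hMφ s a ‖a‖ (norm_nonneg _) fun j _ => c0_coord_le a j)
  refine ⟨J, ε / 2, half_pos hε, fun a => ?_⟩
  have hcoord : ∀ k, ε * |a k| ≤ ‖J a‖ + ‖a‖ * (ε / 2) := by
    intro k
    refine ge_of_tendsto ((hJ0 a).norm.add_const _) ?_
    filter_upwards [Filter.eventually_ge_atTop {k}] with s hs
    have hk : k ∈ s := hs (Finset.mem_singleton_self k)
    have h1 := hgle (φ k) (∑ j ∈ s, a j • y (φ j))
    rw [map_sum, ← Finset.add_sum_erase _ _ hk, map_smul, hg2, smul_eq_mul] at h1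
    have h2 : |∑ j ∈ s.erase k, g (φ k) (a j • y (φ j))| ≤ ‖a‖ * (ε / 2) := by
      refine (Finset.abs_sum_le_sum_abs _ _).trans ?_
      refine le_trans ?_ (mul_le_mul_of_nonneg_left
        (hoff k (s.erase k) (Finset.notMem_erase k s)) (norm_nonneg a))
      rw [Finset.mul_sum]
      refine Finset.sum_le_sum fun j _ => ?_
      rw [map_smul, smul_eq_mul, abs_mul]
      exact mul_le_mul_of_nonneg_right (c0_coord_le a j) (abs_nonneg _)
    have h3 : ε * |a k| ≤ |a k * ‖y (φ k)‖| := by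
      rw [abs_mul, abs_norm, mul_comm]
      exact mul_le_mul_of_nonneg_left (hy _) (abs_nonneg _)
    have h4 := abs_sub_abs_le_abs_add (a k * ‖y (φ k)‖)
      (∑ j ∈ s.erase k, g (φ k) (a j • y (φ j)))
    linarith
  have hn : ‖a‖ ≤ (‖J a‖ + ‖a‖ * (ε / 2)) / ε := by
    rw [← ZeroAtInftyContinuousMap.norm_toBCF_eq_norm,
      BoundedContinuousFunction.norm_le (by positivity)]
    intro k
    rw [le_div_iff₀ hε, mul_comm, ZeroAtInftyContinuousMap.norm_toBCF_eq_norm]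
    exact hcoord k
  rw [le_div_iff₀ hε] at hn
  linarith

/-- If `Y` contains no isomorphic copy of `c₀` and `T : C₀(L, X) → Y` is a continuous
linear operator, then for every sequence of pairwise disjoint nonempty open subsets
`V n` of `L` one has `osc_T(V n) → 0`. -/
theorem oscT_tendsto_zero
    (L : Type*) [TopologicalSpace L] [LocallyCompactSpace L] [T2Space L]
    (X Y : Type*) [NormedAddCommGroup X] [NormedSpace ℝ X] [CompleteSpace X]
    [NormedAddCommGroup Y] [NormedSpace ℝ Y] [CompleteSpace Y]
    (hY : ¬ ∃ J : C₀(ℕ, ℝ) →L[ℝ] Y, ∃ c > 0, ∀ f : C₀(ℕ, ℝ), c * ‖f‖ ≤ ‖J f‖)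
    (T : C₀(L, X) →L[ℝ] Y)
    (V : ℕ → Set L) (hVopen : ∀ n, IsOpen (V n)) (hVne : ∀ n, (V n).Nonempty)
    (hVdisj : Pairwise (Function.onFun Disjoint V)) :
    Filter.Tendsto (fun n => oscT T (V n)) Filter.atTop (nhds 0) := by
  by_contra hcon
  apply hY
  have hnn : ∀ A, 0 ≤ oscT T A := fun A =>
    Real.sSup_nonneg (by rintro r ⟨F, _, _, rfl⟩; exact norm_nonneg _)
  rw [Metric.tendsto_nhds] at hcon
  push Not at hcon
  obtain ⟨ε, hε, hfr⟩ := hcon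
  obtain ⟨ψ, hψ, hψ'⟩ := Filter.extraction_of_frequently_atTop hfr
  have hF : ∀ n, ∃ F : C₀(L, X), ‖F‖ ≤ 1 ∧ (∀ t ∉ V (ψ n), F t = 0) ∧ ε / 2 ≤ ‖T F‖ := by
    intro n
    have h1 := hψ' n
    rw [Real.dist_eq, sub_zero, abs_of_nonneg (hnn _)] at h1
    have h2 : ε / 2 < oscT T (V (ψ n)) := by linarith
    obtain ⟨r, ⟨F, hF1, hF2, rfl⟩, hr⟩ := exists_lt_of_lt_csSup
      (⟨‖T 0‖, 0, by simp, by simp, rfl⟩ : Set.Nonempty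
        {r : ℝ | ∃ F : C₀(L, X), ‖F‖ ≤ 1 ∧ (∀ t ∉ V (ψ n), F t = 0) ∧ r = ‖T F‖}) h2
    exact ⟨F, hF1, hF2, hr.le⟩
  choose F hF1 hF2 hF3 using hF
  refine exists_c0_copy (fun n => T (F n)) ‖T‖ (ε / 2) T.opNorm_nonneg (half_pos hε) hF3 ?_
  intro s a C hC ha
  have e : ∑ j ∈ s, a j • T (F j) = T (∑ j ∈ s, a j • F j) := by simp [map_sum]
  rw [e]
  refine T.le_opNorm_of_le ?_
  rw [← ZeroAtInftyContinuousMap.norm_toBCF_eq_norm, BoundedContinuousFunction.norm_le hC]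
  intro t
  have hpt : (∑ j ∈ s, a j • F j).toBCF t = ∑ j ∈ s, a j • F j t := by
    change (∑ j ∈ s, a j • F j) t = _
    clear ha e
    induction s using Finset.induction_on with
    | empty => simp
    | insert i s hi ih => rw [Finset.sum_insert hi, Finset.sum_insert hi, ← ih]; rfl
  rw [hpt]
  by_cases h : ∃ j ∈ s, t ∈ V (ψ j)
  · obtain ⟨j, hj, htj⟩ := h
    rw [Finset.sum_eq_single_of_mem j hj]
    · rw [norm_smul]
      have h1 : ‖F j t‖ ≤ 1 := by
        refine le_trans ?_ (hF1 j)
        rw [← ZeroAtInftyContinuousMap.norm_toBCF_eq_norm]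
        exact (F j).toBCF.norm_coe_le_norm t
      calc ‖a j‖ * ‖F j t‖ ≤ C * 1 := mul_le_mul (ha j hj) h1 (norm_nonneg _) hC
        _ = C := mul_one C
    · intro i _ hij
      rw [hF2 i t, smul_zero]
      intro hti
      exact Set.disjoint_left.1 (hVdisj (hψ.injective.ne hij)) hti htj
  · push Not at h
    rw [Finset.sum_eq_zero fun j hj => by rw [hF2 j t (h j hj), smul_zero], norm_zero]
    exact hC
end

section
/- Let Γ be a nonempty set, let X be a reflexive real Banach space, and let Y be a real Banach space that does not contain an isomorphic copy of c₀. Then every continuous linear operator T : c₀(Γ,X) → Y is weakly compact, i.e., the closure of the image T(B) of the closed unit ball B of c₀(Γ,X) is compact in the weak topology of Y. -/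
open scoped ZeroAtInfty

set_option linter.unusedSectionVars false

namespace C0Aux

open Filter Topology

section basic

variable {Γ : Type*} [TopologicalSpace Γ] [DiscreteTopology Γ]
variable {X : Type*} [NormedAddCommGroup X] [NormedSpace ℝ X]

/-- Build an element of `c₀`. -/
def mk (f : Γ → X) (hf : ∀ ε > 0, {γ | ε ≤ ‖f γ‖}.Finite) : C₀(Γ, X) where
  toFun := f
  continuous_toFun := continuous_of_discreteTopology
  zero_at_infty' := by
    rw [cocompact_eq_cofinite, Metric.tendsto_nhds]
    intro ε hε
    simpa [Filter.eventually_cofinite] using hf ε hε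

@[simp] lemma mk_apply (f : Γ → X) (hf) (γ : Γ) : mk f hf γ = f γ := rfl

lemma finite_le (f : C₀(Γ, X)) {ε : ℝ} (hε : 0 < ε) : {γ | ε ≤ ‖f γ‖}.Finite := by
  have h := f.zero_at_infty'
  rw [cocompact_eq_cofinite, Metric.tendsto_nhds] at h
  simpa [Filter.eventually_cofinite] using h ε hε

lemma norm_le (f : C₀(Γ, X)) {C : ℝ} (hC : 0 ≤ C) : ‖f‖ ≤ C ↔ ∀ γ, ‖f γ‖ ≤ C := by
  rw [← ZeroAtInftyContinuousMap.norm_toBCF_eq_norm, BoundedContinuousFunction.norm_le hC]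
  rfl

lemma apply_le (f : C₀(Γ, X)) (γ : Γ) : ‖f γ‖ ≤ ‖f‖ :=
  (norm_le f (norm_nonneg _)).1 le_rfl γ

open Classical in
/-- The function supported at one point. -/
noncomputable def sgl (γ : Γ) : X →L[ℝ] C₀(Γ, X) :=
  LinearMap.mkContinuous
    { toFun := fun x => mk (fun γ' => if γ' = γ then x else 0) (by
        intro ε hε
        refine (Set.finite_singleton γ).subset fun γ' h => ?_
        by_contra hne
        have hne' : γ' ≠ γ := hne
        simp [hne'] at h
        linarith)
      map_add' := by
        intro x y; ext γ'
        by_cases h : γ' = γ <;> simp [h]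
      map_smul' := by
        intro c x; ext γ'
        by_cases h : γ' = γ <;> simp [h] } 1 (by
    intro x
    rw [one_mul, norm_le _ (norm_nonneg _)]
    intro γ'
    by_cases h : γ' = γ <;> simp [h])

open Classical in
lemma sgl_apply (γ γ' : Γ) (x : X) : sgl γ x γ' = if γ' = γ then x else 0 := rfl

lemma sum_apply {ι : Type*} (s : Finset ι) (f : ι → C₀(Γ, X)) (γ : Γ) :
    (∑ i ∈ s, f i) γ = ∑ i ∈ s, f i γ := by
  classical
  induction s using Finset.induction_on with
  | empty => simp
  | insert a s ha ih => simp [Finset.sum_insert ha, ih]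

open Classical in
lemma sum_sgl_apply (s : Finset Γ) (x : Γ → X) (γ : Γ) :
    (∑ i ∈ s, sgl i (x i)) γ = if γ ∈ s then x γ else 0 := by
  rw [sum_apply]
  simp [sgl_apply]

lemma norm_sum_sgl_le (s : Finset Γ) (x : Γ → X) {C : ℝ} (hC : 0 ≤ C) (hx : ∀ γ, ‖x γ‖ ≤ C) :
    ‖∑ i ∈ s, sgl i (x i)‖ ≤ C := by
  classical
  rw [norm_le _ hC]
  intro γ
  rw [sum_sgl_apply]
  split_ifs
  · exact hx γ
  · simpa using hC

lemma hasSum_sgl (f : C₀(Γ, X)) : HasSum (fun γ => sgl γ (f γ)) f := by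
  classical
  unfold HasSum
  rw [SummationFilter.unconditional_filter, Metric.tendsto_atTop]
  intro ε hε
  refine ⟨(finite_le f (half_pos hε)).toFinset, fun s hs => ?_⟩
  rw [dist_eq_norm]
  refine lt_of_le_of_lt ?_ (half_lt_self hε)
  rw [norm_le _ (half_pos hε).le]
  intro γ
  rw [ZeroAtInftyContinuousMap.sub_apply, sum_sgl_apply]
  split_ifs with h
  · simpa using (half_pos hε).le
  · by_contra hc
    push Not at hc
    apply h
    apply hs
    simp at hc ⊢
    exact hc.le

open Classical in
lemma exists_block (G : ℕ → Finset Γ) (hG : ∀ m n, m ≠ n → Disjoint (G m) (G n))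
    (x : ℕ → Γ → X) (hx : ∀ n γ, ‖x n γ‖ ≤ 1) :
    ∃ J : C₀(ℕ, ℝ) →L[ℝ] C₀(Γ, X), ∀ n, J (sgl n 1) = ∑ γ ∈ G n, sgl γ (x n γ) := by
  have huniq : ∀ m n γ, γ ∈ G m → γ ∈ G n → m = n := by
    intro m n γ h1 h2
    by_contra hne
    exact Finset.disjoint_left.1 (hG m n hne) h1 h2
  let N : Γ → ℕ := fun γ => if h : ∃ n, γ ∈ G n then h.choose else 0
  have hN : ∀ γ n, γ ∈ G n → N γ = n := by
    intro γ n h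
    have h' : ∃ n, γ ∈ G n := ⟨n, h⟩
    have : N γ = h'.choose := dif_pos h'
    rw [this]
    exact huniq _ _ γ h'.choose_spec h
  let g : Γ → X := fun γ => if ∃ n, γ ∈ G n then x (N γ) γ else 0
  have hg1 : ∀ γ, ‖g γ‖ ≤ 1 := by
    intro γ
    by_cases h : ∃ n, γ ∈ G n
    · simpa [g, h] using hx _ _
    · simp only [g, h]; simp
  have hb : ∀ (a : C₀(ℕ, ℝ)) γ, ‖a (N γ) • g γ‖ ≤ ‖a (N γ)‖ := by
    intro a γ
    rw [norm_smul]
    exact mul_le_of_le_one_right (norm_nonneg _) (hg1 γ)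
  let L : C₀(ℕ, ℝ) →ₗ[ℝ] C₀(Γ, X) :=
    { toFun := fun a => mk (fun γ => a (N γ) • g γ) (by
        intro ε hε
        refine ((finite_le a hε).biUnion (t := fun n => (G n : Set Γ))
          (fun n _ => (G n).finite_toSet)).subset ?_
        intro γ hγ
        have h1 : ε ≤ ‖a (N γ) • g γ‖ := hγ
        simp only [Set.mem_iUnion, Set.mem_ofPred_eq]
        refine ⟨N γ, h1.trans (hb a γ), ?_⟩
        by_cases h : ∃ n, γ ∈ G n
        · obtain ⟨n, hn⟩ := h
          rw [hN γ n hn]; exact hn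
        · exfalso
          simp only [g, h] at h1
          simp at h1
          linarith)
      map_add' := by intro a b; ext γ; simp [add_smul]
      map_smul' := by intro c a; ext γ; simp [mul_smul] }
  refine ⟨L.mkContinuous 1 ?_, ?_⟩
  · intro a
    rw [one_mul, norm_le _ (norm_nonneg _)]
    intro γ
    exact (hb a γ).trans (apply_le a _)
  · intro n
    ext γ
    rw [sum_sgl_apply]
    change (sgl n (1 : ℝ) : C₀(ℕ, ℝ)) (N γ) • g γ = _
    rw [sgl_apply]
    by_cases h : ∃ n, γ ∈ G n
    · obtain ⟨m, hm⟩ := h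
      have hgm : g γ = x m γ := by
        have : ∃ n, γ ∈ G n := ⟨m, hm⟩
        simp only [g, this, if_true, hN γ m hm]
      rw [hN γ m hm, hgm]
      by_cases hmn : m = n
      · subst hmn; simp [hm]
      · have : γ ∉ G n := fun h' => hmn (huniq _ _ γ hm h')
        simp [hmn, this]
    · have hgm : g γ = 0 := by simp only [g, h, if_false]
      have : γ ∉ G n := fun h' => h ⟨n, h'⟩
      simp [hgm, this]

end basic

open scoped ENNReal

/-- The Rosenthal disjointification lemma. -/
lemma rosenthal (δ : ℝ≥0∞) (hδ : δ ≠ ⊤) (k : ℕ) : ∀ a : ℕ → ℕ → ℝ≥0∞,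
    (∀ n, ∑' m, a n m ≤ k * δ) →
    ∃ φ : ℕ → ℕ, Function.Injective φ ∧
      ∀ n, ∑' m, (if m = n then 0 else a (φ n) (φ m)) ≤ δ := by
  induction k with
  | zero =>
    intro a h
    refine ⟨id, Function.injective_id, fun n => ?_⟩
    have h0 := h n
    simp only [Nat.cast_zero, zero_mul, nonpos_iff_eq_zero, ENNReal.tsum_eq_zero] at h0
    simp [h0]
  | succ k ih =>
    intro a h
    by_cases hc : ∃ i, ∀ j, ∑' j', (if j' = j then 0 else a (Nat.pair i j) (Nat.pair i j')) ≤ δ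
    · obtain ⟨i, hi⟩ := hc
      exact ⟨fun j => Nat.pair i j, fun j j' hj => (Nat.pair_eq_pair.1 hj).2, hi⟩
    · push Not at hc
      choose j hj using hc
      have hinj : Function.Injective (fun i => Nat.pair i (j i)) :=
        fun i i' h => (Nat.pair_eq_pair.1 h).1
      obtain ⟨φ, hφ, hφ'⟩ := ih (fun i i' => a (Nat.pair i (j i)) (Nat.pair i' (j i'))) (by
        intro i
        have h1 := h (Nat.pair i (j i))
        have h2 : ∑' i', a (Nat.pair i (j i)) (Nat.pair i' (j i')) +
            ∑' j', (if j' = j i then 0 else a (Nat.pair i (j i)) (Nat.pair i j'))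
            ≤ ∑' m, a (Nat.pair i (j i)) m := by
          set b := a (Nat.pair i (j i)) with hb
          have e1 : ∑' m, b m = ∑' p : ℕ × ℕ, b (Nat.pair p.1 p.2) :=
            (Nat.pairEquiv.tsum_eq b).symm
          have e2 : ∑' p : ℕ × ℕ, b (Nat.pair p.1 p.2) = ∑' i', ∑' j', b (Nat.pair i' j') :=
            ENNReal.tsum_prod (f := fun i' j' => b (Nat.pair i' j'))
          rw [e1, e2, ENNReal.tsum_eq_add_tsum_ite (f := fun i' => ∑' j', b (Nat.pair i' j')) i,
            ENNReal.tsum_eq_add_tsum_ite (f := fun i' => b (Nat.pair i' (j i'))) i,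
            ENNReal.tsum_eq_add_tsum_ite (f := fun j' => b (Nat.pair i j')) (j i),
            add_right_comm]
          refine add_le_add (add_le_add le_rfl (ENNReal.tsum_le_tsum fun x => ?_))
            (ENNReal.tsum_le_tsum fun i' => ?_)
          · split_ifs <;> exact le_rfl
          split_ifs
          · exact le_rfl
          · exact ENNReal.le_tsum (f := fun j' => b (Nat.pair i' j')) (j i')
        have h3 : ∑' i', a (Nat.pair i (j i)) (Nat.pair i' (j i')) + δ ≤ k * δ + δ := by
          refine le_trans (by gcongr; exact (hj i).le) (h2.trans (h1.trans ?_))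
          push_cast
          rw [add_mul, one_mul]
        exact (ENNReal.add_le_add_iff_right hδ).1 h3)
      exact ⟨fun n => Nat.pair (φ n) (j (φ n)), hinj.comp hφ, hφ'⟩

section main

variable {Y : Type*} [NormedAddCommGroup Y] [NormedSpace ℝ Y]

lemma sgl_smul_one (n : ℕ) (c : ℝ) : (sgl n c : C₀(ℕ, ℝ)) = c • sgl n (1 : ℝ) := by
  rw [← map_smul]; simp

lemma sum_abs_le (ν : StrongDual ℝ C₀(ℕ, ℝ)) (s : Finset ℕ) :
    ∑ m ∈ s, ‖ν (sgl m 1)‖ ≤ ‖ν‖ := by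
  have h1 : ∑ m ∈ s, ‖ν (sgl m 1)‖ = ν (∑ m ∈ s, sgl m (SignType.sign (ν (sgl m 1)) : ℝ)) := by
    rw [map_sum]
    refine Finset.sum_congr rfl fun m _ => ?_
    rw [sgl_smul_one m (SignType.sign (ν (sgl m 1)) : ℝ), map_smul, smul_eq_mul, Real.norm_eq_abs, sign_mul_self]
  rw [h1]
  have h2 : ‖∑ m ∈ s, (sgl m (SignType.sign (ν (sgl m 1)) : ℝ) : C₀(ℕ, ℝ))‖ ≤ 1 := by
    refine norm_sum_sgl_le s (fun m => (SignType.sign (ν (sgl m 1)) : ℝ)) zero_le_one ?_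
    intro m
    rcases SignType.trichotomy (SignType.sign (ν (sgl m 1))) with h | h | h <;> simp [h]
  calc _ ≤ ‖ν (∑ m ∈ s, sgl m (SignType.sign (ν (sgl m 1)) : ℝ))‖ := le_abs_self _
    _ ≤ ‖ν‖ * ‖∑ m ∈ s, (sgl m (SignType.sign (ν (sgl m 1)) : ℝ) : C₀(ℕ, ℝ))‖ := ν.le_opNorm _
    _ ≤ ‖ν‖ := mul_le_of_le_one_right (ContinuousLinearMap.opNorm_nonneg ν) h2

lemma off_diag_le (ν : StrongDual ℝ C₀(ℕ, ℝ)) (n : ℕ) {δ : ℝ} (hδ : 0 ≤ δ)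
    (h : ∑' m, (if m = n then 0 else ‖ν (sgl m 1)‖ₑ) ≤ ENNReal.ofReal δ) (f : C₀(ℕ, ℝ)) :
    ‖f n * ν (sgl n 1)‖ ≤ ‖ν f‖ + δ * ‖f‖ := by
  have hfin : ∀ s : Finset ℕ, ∑ m ∈ s, (if m = n then 0 else ‖ν (sgl m 1)‖) ≤ δ := by
    intro s
    rw [← ENNReal.ofReal_le_ofReal_iff hδ]
    refine le_trans (le_of_eq ?_) ((ENNReal.sum_le_tsum s).trans h)
    rw [ENNReal.ofReal_sum_of_nonneg]
    · refine Finset.sum_congr rfl fun m _ => ?_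
      split_ifs
      · simp
      · exact ofReal_norm _
    · intro m _; split_ifs <;> positivity
  have hs : HasSum (fun m => f m * ν (sgl m 1)) (ν f) := by
    have := (hasSum_sgl f).mapL ν
    have h2 : (fun m => f m * ν (sgl m 1)) = fun m => ν (sgl m (f m)) := by
      funext m
      rw [sgl_smul_one m (f m), map_smul, smul_eq_mul]
    rw [h2]
    exact this
  have hd : HasSum (fun m => if m = n then f m * ν (sgl m 1) else 0) (f n * ν (sgl n 1)) := by
    have := hasSum_ite_eq n (f n * ν (sgl n 1))
    convert this using 2 with m
    split_ifs with hm <;> simp [hm]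
  have hsub := hs.sub hd
  have hle : ‖ν f - f n * ν (sgl n 1)‖ ≤ δ * ‖f‖ := by
    refine le_of_tendsto hsub.norm (Eventually.of_forall fun s => ?_)
    calc _ ≤ ∑ m ∈ s, ‖f m * ν (sgl m 1) - (if m = n then f m * ν (sgl m 1) else 0)‖ :=
          norm_sum_le _ _
      _ ≤ ∑ m ∈ s, (if m = n then 0 else ‖ν (sgl m 1)‖) * ‖f‖ := by
          refine Finset.sum_le_sum fun m _ => ?_
          split_ifs
          · simp
          · rw [sub_zero, norm_mul, mul_comm]
            exact mul_le_mul_of_nonneg_left (apply_le f m) (norm_nonneg _)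
      _ ≤ δ * ‖f‖ := by
          rw [← Finset.sum_mul]
          exact mul_le_mul_of_nonneg_right (hfin s) (norm_nonneg _)
  have := norm_sub_norm_le (f n * ν (sgl n 1)) (ν f)
  rw [norm_sub_rev] at this
  linarith

lemma exists_copy (S : C₀(ℕ, ℝ) →L[ℝ] Y) {ε : ℝ} (hε : 0 < ε)
    (hS : ∀ n, ε ≤ ‖S (sgl n 1)‖) :
    ∃ J : C₀(ℕ, ℝ) →L[ℝ] Y, ∃ c > 0, ∀ f : C₀(ℕ, ℝ), c * ‖f‖ ≤ ‖J f‖ := by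
  choose y hy1 hy2 using fun n => exists_dual_vector'' ℝ (S (sgl n 1))
  obtain ⟨k, hk⟩ := exists_nat_ge (‖S‖ / (ε / 2))
  rw [div_le_iff₀ (half_pos hε)] at hk
  obtain ⟨φ, hφ, hφ'⟩ := rosenthal (ENNReal.ofReal (ε / 2)) ENNReal.ofReal_ne_top k
    (fun n m => ‖y n (S (sgl m 1))‖ₑ) (by
      intro n
      rw [ENNReal.tsum_eq_iSup_sum]
      refine iSup_le fun s => ?_
      have h1 := sum_abs_le ((y n).comp S) s
      have h2 : ‖(y n).comp S‖ ≤ ‖S‖ :=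
        ((y n).opNorm_comp_le S).trans (mul_le_of_le_one_left (norm_nonneg _) (hy1 n))
      have h3 := ENNReal.ofReal_le_ofReal ((h1.trans h2).trans hk)
      rw [ENNReal.ofReal_sum_of_nonneg (fun _ _ => norm_nonneg _),
        ENNReal.ofReal_mul (Nat.cast_nonneg _), ENNReal.ofReal_natCast] at h3
      refine le_trans (le_of_eq ?_) h3
      refine Finset.sum_congr rfl fun m _ => ?_
      exact (ofReal_norm _).symm)
  obtain ⟨R, hR⟩ := exists_block (Γ := ℕ) (X := ℝ) (fun n => {φ n})
    (by intro m n hmn; simpa using fun h => hmn (hφ h)) (fun _ _ => 1) (by simp)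
  have hR' : ∀ n, R (sgl n 1) = sgl (φ n) 1 := by intro n; simpa using hR n
  refine ⟨S.comp R, ε / 2, half_pos hε, fun f => ?_⟩
  have key : ∀ n, ‖f n‖ ≤ (‖S (R f)‖ + ε / 2 * ‖f‖) / ε := by
    intro n
    rw [le_div_iff₀ hε]
    have h1 := off_diag_le ((y (φ n)).comp (S.comp R)) n (half_pos hε).le
      (by simpa [hR'] using hφ' n) f
    have h2 : ‖((y (φ n)).comp (S.comp R)) f‖ ≤ ‖S (R f)‖ := by
      refine ((y (φ n)).le_opNorm _).trans ?_
      exact mul_le_of_le_one_left (norm_nonneg _) (hy1 _)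
    have h3 : ((y (φ n)).comp (S.comp R)) (sgl n 1) = ‖S (sgl (φ n) 1)‖ := by
      simpa [hR'] using hy2 (φ n)
    rw [h3, norm_mul, norm_norm] at h1
    have h4 := mul_le_mul_of_nonneg_left (hS (φ n)) (norm_nonneg (f n))
    linarith
  have := (norm_le f (by positivity)).2 key
  rw [le_div_iff₀ hε] at this
  change ε / 2 * ‖f‖ ≤ ‖S (R f)‖
  linarith

variable {Γ : Type*} [TopologicalSpace Γ] [DiscreteTopology Γ]
variable {X : Type*} [NormedAddCommGroup X] [NormedSpace ℝ X]

lemma small_tails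
    (hY : ¬ ∃ J : C₀(ℕ, ℝ) →L[ℝ] Y, ∃ c > 0, ∀ f : C₀(ℕ, ℝ), c * ‖f‖ ≤ ‖J f‖)
    (T : C₀(Γ, X) →L[ℝ] Y) {ε : ℝ} (hε : 0 < ε) :
    ∃ F : Finset Γ, ∀ G : Finset Γ, Disjoint G F → ∀ x : Γ → X, (∀ γ, ‖x γ‖ ≤ 1) →
      ‖∑ γ ∈ G, T (sgl γ (x γ))‖ < ε := by
  classical
  by_contra hc
  push Not at hc
  choose G hG x hx hGx using hc
  let F : ℕ → Finset Γ := fun n => Nat.rec ∅ (fun _ A => A ∪ G A) n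
  have hF : ∀ n, F (n + 1) = F n ∪ G (F n) := fun n => rfl
  have hmono : Monotone F := monotone_nat_of_le_succ fun n => by
    rw [hF]; exact Finset.subset_union_left
  have hlt : ∀ m n, m < n → Disjoint (G (F m)) (G (F n)) := by
    intro m n hmn
    refine ((hG (F n)).mono_right ?_).symm
    refine le_trans ?_ (hmono (Nat.succ_le_of_lt hmn))
    rw [Nat.succ_eq_add_one, hF]
    exact Finset.subset_union_right
  obtain ⟨J, hJ⟩ := exists_block (fun n => G (F n))
    (fun m n hmn => by
      rcases lt_or_gt_of_ne hmn with h | h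
      · exact hlt m n h
      · exact (hlt n m h).symm) (fun n => x (F n)) (fun n => hx _)
  refine hY (exists_copy (T.comp J) hε fun n => ?_)
  rw [ContinuousLinearMap.comp_apply, hJ, map_sum]
  exact hGx _

lemma isCompact_ball (hX : Function.Surjective (NormedSpace.inclusionInDoubleDual ℝ X)) :
    IsCompact (closure (toWeakSpace ℝ X '' Metric.closedBall (0 : X) 1)) := by
  refine NormedSpace.isCompact_closure_of_isBounded ℝ X _ ?_ ?_
  · rw [Set.preimage_image_eq _ (toWeakSpace ℝ X).injective]
    exact Metric.isBounded_closedBall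
  · intro z _
    obtain ⟨x, hx⟩ := hX (WeakDual.toStrongDual z)
    exact ⟨toWeakSpace ℝ X x, by rw [NormedSpace.inclusionInDoubleDualWeak_apply]; exact hx⟩

lemma weak_closed_ball :
    closure (toWeakSpace ℝ X '' Metric.closedBall (0 : X) 1) =
      toWeakSpace ℝ X '' Metric.closedBall (0 : X) 1 := by
  rw [← (convex_closedBall (0 : X) 1).toWeakSpace_closure ℝ, Metric.isClosed_closedBall.closure_eq]

end main

end C0Aux

/-- If `Γ` is a nonempty set (viewed as a discrete topological space, so that
`c₀(Γ, X) = C₀(Γ, X)`), `X` is a reflexive real Banach space and `Y` is a real Banach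
space containing no isomorphic copy of `c₀`, then every continuous linear operator
`T : c₀(Γ, X) → Y` is weakly compact: the closure of the image of the closed unit ball
is compact in the weak topology of `Y`. -/
theorem weaklyCompact_of_reflexive_of_no_c0
    (Γ : Type*) [TopologicalSpace Γ] [DiscreteTopology Γ] [Nonempty Γ]
    (X : Type*) [NormedAddCommGroup X] [NormedSpace ℝ X] [CompleteSpace X]
    (hX : Function.Surjective (NormedSpace.inclusionInDoubleDual ℝ X))
    (Y : Type*) [NormedAddCommGroup Y] [NormedSpace ℝ Y] [CompleteSpace Y]
    (hY : ¬ ∃ J : C₀(ℕ, ℝ) →L[ℝ] Y, ∃ c > 0, ∀ f : C₀(ℕ, ℝ), c * ‖f‖ ≤ ‖J f‖)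
    (T : C₀(Γ, X) →L[ℝ] Y) :
    IsCompact (closure
      ((toWeakSpaceCLM ℝ Y) '' (T '' Metric.closedBall 0 1))) := by
  classical
  have hball : IsCompact (toWeakSpace ℝ X '' Metric.closedBall (0 : X) 1) := by
    have := C0Aux.isCompact_ball hX
    rwa [C0Aux.weak_closed_ball] at this
  let e : WeakSpace ℝ X ≃ₗ[ℝ] X := (toWeakSpace ℝ X).symm
  let K : Set (Γ → WeakSpace ℝ X) :=
    Set.pi Set.univ fun _ => toWeakSpace ℝ X '' Metric.closedBall (0 : X) 1
  have hK : IsCompact K := isCompact_univ_pi fun _ => hball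
  have hKn : ∀ x ∈ K, ∀ γ, ‖e (x γ)‖ ≤ 1 := by
    intro x hx γ
    obtain ⟨u, hu, hux⟩ := hx γ (Set.mem_univ _)
    rw [← hux]
    simpa [e] using hu
  have hsum : ∀ x ∈ K, Summable fun γ => T (C0Aux.sgl γ (e (x γ))) := by
    intro x hx
    rw [summable_iff_vanishing_norm]
    intro ε hε
    obtain ⟨F, hF⟩ := C0Aux.small_tails hY T hε
    exact ⟨F, fun G hG => hF G hG (fun γ => e (x γ)) (hKn x hx)⟩
  let Φ : (Γ → WeakSpace ℝ X) → Y := fun x => ∑' γ, T (C0Aux.sgl γ (e (x γ)))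
  have hcont : ContinuousOn (fun x => toWeakSpaceCLM ℝ Y (Φ x)) K := by
    rw [continuousOn_iff_continuous_domRestrict]
    refine WeakBilin.continuous_of_continuous_eval _ fun g => ?_
    change Continuous fun x : K => g (Φ x)
    have hunif : TendstoUniformly
        (fun (s : Finset Γ) (x : K) => ∑ γ ∈ s, g (T (C0Aux.sgl γ (e (x.1 γ)))))
        (fun x : K => g (Φ x)) Filter.atTop := by
      rw [Metric.tendstoUniformly_iff]
      intro ε hε
      have hpos : 0 < ‖g‖ + 1 := by positivity
      obtain ⟨F, hF⟩ := C0Aux.small_tails hY T (div_pos hε hpos)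
      filter_upwards [Filter.eventually_ge_atTop F] with s hs x
      have h1 : ‖Φ x - ∑ γ ∈ s, T (C0Aux.sgl γ (e (x.1 γ)))‖ ≤ ε / (‖g‖ + 1) := by
        have ht := ((hsum x.1 x.2).hasSum.sub_const
          (∑ γ ∈ s, T (C0Aux.sgl γ (e (x.1 γ)))) : Filter.Tendsto _ _ _).norm
        refine le_of_tendsto ht ?_
        filter_upwards [Filter.eventually_ge_atTop s] with t hts
        rw [← Finset.sum_sdiff hts, add_sub_cancel_right]
        exact (hF _ (Finset.sdiff_disjoint.mono_right hs) (fun γ => e (x.1 γ)) (hKn x.1 x.2)).le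
      rw [dist_eq_norm, ← map_sum, ← map_sub]
      calc _ ≤ ‖g‖ * ‖Φ x - ∑ γ ∈ s, T (C0Aux.sgl γ (e (x.1 γ)))‖ := g.le_opNorm _
        _ ≤ ‖g‖ * (ε / (‖g‖ + 1)) := by gcongr
        _ < (‖g‖ + 1) * (ε / (‖g‖ + 1)) := by
            have := div_pos hε hpos
            nlinarith
        _ = ε := by field_simp
    refine hunif.continuous (Filter.Frequently.of_forall fun s => ?_)
    refine continuous_finsetSum _ fun γ _ => ?_
    have hev : Continuous fun u : WeakSpace ℝ X =>
        (g.comp (T.comp (C0Aux.sgl γ)) : StrongDual ℝ X) (e u) :=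
      WeakBilin.eval_continuous (topDualPairing ℝ X).flip (g.comp (T.comp (C0Aux.sgl γ)))
    exact hev.comp ((continuous_apply γ).comp continuous_subtype_val)
  have : T2Space (WeakSpace ℝ Y) :=
    (NormedSpace.isEmbedding_inclusionInDoubleDualWeak ℝ Y).t2Space
  refine (hK.image_of_continuousOn hcont).closure_of_subset ?_
  rintro _ ⟨_, ⟨f, hf, rfl⟩, rfl⟩
  refine ⟨fun γ => toWeakSpace ℝ X (f γ), ?_, ?_⟩
  · intro γ _
    refine ⟨f γ, ?_, rfl⟩
    have : ‖f‖ ≤ 1 := by simpa using hf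
    simpa using (C0Aux.apply_le f γ).trans this
  · exact ((C0Aux.hasSum_sgl f).mapL T).tsum_eq
end
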